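/- arXiv:2004.00714 — 3 statements merged into one kernel-verified Lean document; each statement's English description precedes it below -/
import Mathlib

section
/- Let X and Y be centered Gaussian random vectors in ℝⁿ, and let d_X(i,j) = √(E[(X_i − X_j)²]) and d_Y(i,j) = √(E[(Y_i − Y_j)²]). Then d_X = d_Y if and only if there exists a centered Gaussian random vector (Z₁,…,Z_n, W) in ℝ^{n+1} such that (Z₁,…,Z_n) has the same distribution as X and (Z₁ + W, …, Z_n + W) has the same distribution as Y. -/
open MeasureTheory ProbabilityTheory

/-- The standard Gaussian measure on `ℝⁿ` (product of `n` standard Gaussians). -/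
noncomputable def stdGaussianPi (n : ℕ) : Measure (Fin n → ℝ) :=
  Measure.pi fun _ => gaussianReal 0 1

/-- A measure `μ` on `ℝⁿ` is the law of a centered Gaussian random vector with
covariance matrix `C` iff it is the pushforward of the standard Gaussian measure
under a linear map `A` with `A * Aᵀ = C`. -/
def IsCenteredGaussian (n : ℕ) (μ : Measure (Fin n → ℝ))
    (C : Matrix (Fin n) (Fin n) ℝ) : Prop :=
  ∃ A : Matrix (Fin n) (Fin n) ℝ, C = A * A.transpose ∧ μ = (stdGaussianPi n).map A.mulVec

open Matrix in
/-- A linear functional of a standard Gaussian vector is a centered Gaussian variable whose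
variance is the squared Euclidean norm of the functional. -/
theorem stdGaussianPi_map_dotProduct {n : ℕ} (v : Fin n → ℝ) :
    (stdGaussianPi n).map (fun x => v ⬝ᵥ x) = gaussianReal 0 (v ⬝ᵥ v).toNNReal := by
  have : IsProbabilityMeasure (stdGaussianPi n) := by unfold stdGaussianPi; infer_instance
  have hm : Measurable fun x : Fin n → ℝ => v ⬝ᵥ x := by unfold dotProduct; fun_prop
  have : IsProbabilityMeasure ((stdGaussianPi n).map fun x => v ⬝ᵥ x) :=
    Measure.isProbabilityMeasure_map hm.aemeasurable
  refine Measure.ext_of_charFun (funext fun t => ?_)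
  rw [charFun_gaussianReal, charFun_apply_real, integral_map hm.aemeasurable (by fun_prop)]
  have hprod : ∀ x : Fin n → ℝ, Complex.exp (t * (v ⬝ᵥ x : ℝ) * Complex.I) =
      ∏ i, Complex.exp ((t * v i : ℝ) * (x i : ℝ) * Complex.I) := fun x => by
    rw [← Complex.exp_sum, dotProduct, Complex.ofReal_sum, Finset.mul_sum, Finset.sum_mul]
    congr 1
    refine Finset.sum_congr rfl fun i _ => ?_
    push_cast
    ring
  simp_rw [hprod]
  rw [stdGaussianPi, integral_fintype_prod_eq_prod
    (f := fun i (y : ℝ) => Complex.exp ((t * v i : ℝ) * (y : ℝ) * Complex.I))]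
  simp_rw [← charFun_apply_real, charFun_gaussianReal]
  have hv : 0 ≤ v ⬝ᵥ v := Finset.sum_nonneg fun i _ => mul_self_nonneg (v i)
  have hc : (((v ⬝ᵥ v).toNNReal : ℝ) : ℂ) = ((v ⬝ᵥ v : ℝ) : ℂ) := by
    rw [Real.coe_toNNReal _ hv]
  rw [← Complex.exp_sum, hc, dotProduct, Complex.ofReal_sum]
  congr 1
  simp only [Complex.ofReal_zero, mul_zero, zero_mul, zero_sub, NNReal.coe_one,
    Complex.ofReal_one, Finset.sum_mul, Finset.sum_div, Finset.sum_neg_distrib, one_mul]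
  congr 1
  refine Finset.sum_congr rfl fun i _ => ?_
  push_cast
  ring

open Matrix in
theorem measurable_mulVec {m k : ℕ} (A : Matrix (Fin m) (Fin k) ℝ) :
    Measurable (A.mulVec : (Fin k → ℝ) → Fin m → ℝ) := by
  unfold mulVec dotProduct
  fun_prop

open Matrix in
theorem stdGaussianPi_map_mulVec_map_dotProduct {m k : ℕ} (A : Matrix (Fin m) (Fin k) ℝ)
    (w : Fin m → ℝ) :
    ((stdGaussianPi k).map A.mulVec).map (fun x => w ⬝ᵥ x) =
      gaussianReal 0 (w ⬝ᵥ (A * Aᵀ) *ᵥ w).toNNReal := by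
  have hm : Measurable fun x : Fin m → ℝ => w ⬝ᵥ x := by unfold dotProduct; fun_prop
  have hcomp : (fun x => w ⬝ᵥ x) ∘ A.mulVec = fun x => (w ᵥ* A) ⬝ᵥ x :=
    funext fun x => dotProduct_mulVec w A x
  rw [Measure.map_map hm (measurable_mulVec A), hcomp, stdGaussianPi_map_dotProduct]
  congr 2
  rw [← mulVec_mulVec, dotProduct_mulVec, mulVec_transpose]

open Matrix in
/-- The law of a linear image of a standard Gaussian vector depends only on its covariance. -/
theorem stdGaussianPi_map_mulVec_eq {m k l : ℕ} {A : Matrix (Fin m) (Fin k) ℝ}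
    {B : Matrix (Fin m) (Fin l) ℝ} (h : A * Aᵀ = B * Bᵀ) :
    (stdGaussianPi k).map A.mulVec = (stdGaussianPi l).map B.mulVec := by
  have : ∀ j, IsProbabilityMeasure (stdGaussianPi j) := fun j => by
    unfold stdGaussianPi; infer_instance
  have := Measure.isProbabilityMeasure_map (μ := stdGaussianPi k) (measurable_mulVec A).aemeasurable
  have := Measure.isProbabilityMeasure_map (μ := stdGaussianPi l) (measurable_mulVec B).aemeasurable
  refine Measure.ext_of_charFunDual (funext fun L => ?_)
  have hL : (L : (Fin m → ℝ) → ℝ) = fun x => (fun i => L (Pi.single i 1)) ⬝ᵥ x := by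
    funext x
    conv_lhs => rw [pi_eq_sum_univ' x, map_sum]
    refine Finset.sum_congr rfl fun i _ => ?_
    rw [map_smul, smul_eq_mul, mul_comm]
  rw [charFunDual_eq_charFun_map_one, charFunDual_eq_charFun_map_one, hL,
    stdGaussianPi_map_mulVec_map_dotProduct, stdGaussianPi_map_mulVec_map_dotProduct, h]

open Matrix in
theorem IsCenteredGaussian.integral_dotProduct_sq {n : ℕ} {μ : Measure (Fin n → ℝ)}
    {C : Matrix (Fin n) (Fin n) ℝ} (h : IsCenteredGaussian n μ C) (w : Fin n → ℝ) :
    ∫ x, (w ⬝ᵥ x) ^ 2 ∂μ = w ⬝ᵥ C *ᵥ w := by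
  obtain ⟨A, rfl, rfl⟩ := h
  have hm : Measurable fun x : Fin n → ℝ => w ⬝ᵥ x := by unfold dotProduct; fun_prop
  have hmap := integral_map (μ := (stdGaussianPi n).map A.mulVec) hm.aemeasurable
    (f := fun y : ℝ => y ^ 2) (by fun_prop)
  have hnn : 0 ≤ w ⬝ᵥ (A * Aᵀ) *ᵥ w := by
    rw [← mulVec_mulVec, dotProduct_mulVec, mulVec_transpose]
    exact Finset.sum_nonneg fun i _ => mul_self_nonneg _
  rw [← hmap, stdGaussianPi_map_mulVec_map_dotProduct]
  have hvar := variance_fun_id_gaussianReal (μ := 0) (v := (w ⬝ᵥ (A * Aᵀ) *ᵥ w).toNNReal)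
  rw [variance_of_integral_eq_zero (by fun_prop) integral_id_gaussianReal,
    Real.coe_toNNReal _ hnn] at hvar
  exact hvar

open Matrix MatrixOrder in
theorem Matrix.PosSemidef.exists_eq_mul_transpose {m : ℕ} {C : Matrix (Fin m) (Fin m) ℝ}
    (hC : C.PosSemidef) : ∃ A : Matrix (Fin m) (Fin m) ℝ, C = A * Aᵀ := by
  obtain ⟨X, hX, -, h⟩ := CFC.exists_sqrt_of_isSelfAdjoint_of_quasispectrumRestricts
    hC.isHermitian (QuasispectrumRestricts.nnreal_of_nonneg hC.nonneg)
  refine ⟨X, h.symm.trans ?_⟩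
  rw [← conjTranspose_eq_transpose_of_trivial, ← star_eq_conjTranspose, hX.star_eq]

open Matrix in
theorem IsCenteredGaussian.posSemidef {n : ℕ} {μ : Measure (Fin n → ℝ)}
    {C : Matrix (Fin n) (Fin n) ℝ} (h : IsCenteredGaussian n μ C) : C.PosSemidef := by
  obtain ⟨A, rfl, -⟩ := h
  rw [← conjTranspose_eq_transpose_of_trivial]
  exact posSemidef_self_mul_conjTranspose A

open Matrix in
/-- If a positive semidefinite form plus `2 (∑ i, u i) (a ⬝ᵥ u)` is nonnegative, then there is a
multiplier `w` of the constraint `∑ i, u i = 1` making the affine relaxation nonnegative. -/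
theorem Matrix.PosSemidef.exists_multiplier {n : ℕ} {C : Matrix (Fin n) (Fin n) ℝ}
    (hC : C.PosSemidef) {a : Fin n → ℝ}
    (ha : ∀ u : Fin n → ℝ, 0 ≤ u ⬝ᵥ C *ᵥ u + 2 * (1 ⬝ᵥ u) * (a ⬝ᵥ u)) :
    ∃ w : ℝ, ∀ u : Fin n → ℝ, 0 ≤ u ⬝ᵥ C *ᵥ u + 2 * (a ⬝ᵥ u) + w * (1 - 1 ⬝ᵥ u) := by
  rcases n with - | n
  · exact ⟨0, fun u => by simp [dotProduct]⟩
  have hq : ∀ u : Fin (n + 1) → ℝ, 0 ≤ u ⬝ᵥ C *ᵥ u := fun u => by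
    simpa using hC.dotProduct_mulVec_nonneg u
  have hsymm : ∀ u v : Fin (n + 1) → ℝ, v ⬝ᵥ C *ᵥ u = u ⬝ᵥ C *ᵥ v := fun u v => by
    rw [dotProduct_mulVec, dotProduct_comm, ← mulVec_transpose,
      ← conjTranspose_eq_transpose_of_trivial, hC.isHermitian.eq]
  set f : (Fin (n + 1) → ℝ) → ℝ := fun u => u ⬝ᵥ C *ᵥ u + 2 * (a ⬝ᵥ u) with hf
  have key : ∀ u v : Fin (n + 1) → ℝ, 1 ⬝ᵥ u < (1 : ℝ) → 1 < (1 : Fin (n + 1) → ℝ) ⬝ᵥ v →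
      0 ≤ (1 ⬝ᵥ v - 1) * f u + (1 - 1 ⬝ᵥ u) * f v := by
    intro u v hu hv
    have hz := ha ((1 ⬝ᵥ v - 1) • u + (1 - 1 ⬝ᵥ u) • v)
    have hd := hq (u - v)
    simp only [mulVec_add, mulVec_sub, mulVec_smul, add_dotProduct, dotProduct_add,
      sub_dotProduct, dotProduct_sub, smul_dotProduct, dotProduct_smul, smul_eq_mul,
      hsymm u v] at hz hd
    simp only [hf]
    generalize 1 ⬝ᵥ u = s at *
    generalize 1 ⬝ᵥ v = t at *
    generalize u ⬝ᵥ C *ᵥ u = p at *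
    generalize v ⬝ᵥ C *ᵥ v = q at *
    generalize u ⬝ᵥ C *ᵥ v = b at *
    have h1 : 0 < t - s := by linarith
    have h2 : 0 ≤ (t - 1) * (1 - s) := mul_nonneg (by linarith) (by linarith)
    have h3 := mul_nonneg h2 hd
    refine nonneg_of_mul_nonneg_right (a := t - s) ?_ h1
    nlinarith
  obtain ⟨w, hw₁, hw₂⟩ := exists_between_of_forall_le
    (s := (fun u => -f u / (1 - 1 ⬝ᵥ u)) '' {u | 1 ⬝ᵥ u < (1 : ℝ)})
    (t := (fun v => f v / (1 ⬝ᵥ v - 1)) '' {v | 1 < (1 : Fin (n + 1) → ℝ) ⬝ᵥ v})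
    ⟨_, 0, by simp, rfl⟩ ⟨_, Pi.single 0 2, by simp, rfl⟩ (by
      rintro _ ⟨u, hu, rfl⟩ _ ⟨v, hv, rfl⟩
      have h := key u v hu hv
      rw [Set.mem_ofPred_eq] at hu hv
      simp only
      rw [div_le_div_iff₀ (by linarith) (by linarith)]
      linarith)
  refine ⟨w, fun u => ?_⟩
  change 0 ≤ f u + _
  rcases lt_trichotomy (1 ⬝ᵥ u) (1 : ℝ) with hu | hu | hu
  · have h := hw₁ ⟨u, hu, rfl⟩
    simp only at h
    rw [div_le_iff₀ (by linarith)] at h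
    linarith
  · have h := ha u
    rw [hu] at h ⊢
    simp only [hf]
    linarith
  · have h := hw₂ ⟨u, hu, rfl⟩
    simp only at h
    rw [le_div_iff₀ (by linarith)] at h
    linarith

open Matrix in
/-- If adding `a i + a j` to a positive semidefinite matrix keeps it positive semidefinite, the
matrix extends to the covariance of a vector with one more coordinate `W` such that shifting all
the other coordinates by `W` realizes this perturbation. -/
theorem Matrix.PosSemidef.exists_extension {n : ℕ} {C D : Matrix (Fin n) (Fin n) ℝ}
    (hC : C.PosSemidef) (hD : D.PosSemidef) {a : Fin n → ℝ}
    (hCD : ∀ i j, D i j = C i j + a i + a j) :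
    ∃ E : Matrix (Fin (n + 1)) (Fin (n + 1)) ℝ, E.PosSemidef ∧
      (∀ i j : Fin n, E i.castSucc j.castSucc = C i j) ∧
      ∀ i j : Fin n, E i.castSucc j.castSucc + E i.castSucc (Fin.last n) +
        E (Fin.last n) j.castSucc + E (Fin.last n) (Fin.last n) = D i j := by
  obtain ⟨w, hw⟩ := hC.exists_multiplier (a := a) fun u => by
    have h := hD.dotProduct_mulVec_nonneg u
    have hD' : D = C + vecMulVec a 1 + vecMulVec 1 a := by
      ext i j
      simp [hCD]
    rw [hD'] at h
    simp only [star_trivial, add_mulVec, add_dotProduct, vecMulVec_mulVec, op_smul_eq_smul,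
      smul_dotProduct, smul_eq_mul, dotProduct_comm u] at h
    rw [dotProduct_comm u]
    linarith
  refine ⟨Matrix.of (Fin.snoc (fun i => Fin.snoc (C i) (a i - w / 2))
    (Fin.snoc (fun j => a j - w / 2) w)), ?_, by simp, fun i j => ?_⟩
  · refine .of_dotProduct_mulVec_nonneg ?_ fun x => ?_
    · ext i j
      have hs : ∀ i j, C j i = C i j := fun i j => by simpa using hC.isHermitian.apply i j
      refine Fin.lastCases ?_ (fun i => ?_) i <;> refine Fin.lastCases ?_ (fun j => ?_) j <;>
        simp [hs]
    · have hexp : star x ⬝ᵥ (Matrix.of (Fin.snoc (fun i => Fin.snoc (C i) (a i - w / 2))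
          (Fin.snoc (fun j => a j - w / 2) w)) : Matrix (Fin (n + 1)) (Fin (n + 1)) ℝ) *ᵥ x =
          Fin.init x ⬝ᵥ C *ᵥ Fin.init x + 2 * x (Fin.last n) * (a ⬝ᵥ Fin.init x) -
            w * x (Fin.last n) * (1 ⬝ᵥ Fin.init x) + w * x (Fin.last n) ^ 2 := by
        have hsplit : ∀ y z : Fin (n + 1) → ℝ,
            y ⬝ᵥ z = Fin.init y ⬝ᵥ Fin.init z + y (Fin.last n) * z (Fin.last n) :=
          fun y z => Fin.sum_univ_castSucc _
        have hinit : ∀ (y : Fin n → Fin (n + 1) → ℝ) z, Fin.init (Matrix.of (Fin.snoc y z) *ᵥ x) =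
            fun i => y i ⬝ᵥ x := fun y z => by
          ext i
          simp [Fin.init, mulVec]
        have hlast : ∀ (y : Fin n → Fin (n + 1) → ℝ) z,
            (Matrix.of (Fin.snoc y z) *ᵥ x) (Fin.last n) = z ⬝ᵥ x := fun y z => by
          simp [mulVec]
        have ha : (fun j => a j - w / 2) = a - (w / 2) • (1 : Fin n → ℝ) := by
          ext
          simp
        have hv : (fun i => C i ⬝ᵥ Fin.init x + (a i - w / 2) * x (Fin.last n)) =
            C *ᵥ Fin.init x + x (Fin.last n) • (a - (w / 2) • (1 : Fin n → ℝ)) := by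
          ext i
          simp [mulVec, mul_comm]
        rw [star_trivial, hsplit, hinit, hlast]
        simp only [hsplit _ x, Fin.init_snoc, Fin.snoc_last]
        rw [hv, ha]
        simp only [dotProduct_add, dotProduct_sub, dotProduct_smul, sub_dotProduct,
          smul_dotProduct, smul_eq_mul, dotProduct_comm (Fin.init x) a,
          dotProduct_comm (Fin.init x) 1]
        ring
      rw [hexp]
      rcases eq_or_ne (x (Fin.last n)) 0 with ht | ht
      · simpa [ht] using hC.dotProduct_mulVec_nonneg (Fin.init x)
      · have h := mul_nonneg (sq_nonneg (x (Fin.last n))) (hw ((x (Fin.last n))⁻¹ • Fin.init x))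
        simp only [mulVec_smul, smul_dotProduct, dotProduct_smul, smul_eq_mul] at h
        field_simp at h
        linarith
  · simp only [of_apply, Fin.snoc_castSucc, Fin.snoc_last, hCD]
    ring

theorem measurable_comp_castSucc {n : ℕ} :
    Measurable fun (v : Fin (n + 1) → ℝ) (i : Fin n) => v i.castSucc := by fun_prop

theorem measurable_comp_castSucc_add_last {n : ℕ} :
    Measurable fun (v : Fin (n + 1) → ℝ) (i : Fin n) => v i.castSucc + v (Fin.last n) := by
  fun_prop

open Matrix in
theorem IsCenteredGaussian.integral_sub_sq {n : ℕ} {μ : Measure (Fin n → ℝ)}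
    {C : Matrix (Fin n) (Fin n) ℝ} (h : IsCenteredGaussian n μ C) (i j : Fin n) :
    ∫ x, (x i - x j) ^ 2 ∂μ = C i i + C j j - 2 * C i j := by
  have hs : C j i = C i j := by simpa using h.posSemidef.isHermitian.apply i j
  have := h.integral_dotProduct_sq (Pi.single i 1 - Pi.single j 1)
  simp only [sub_dotProduct, single_dotProduct, one_mul, mulVec_sub, mulVec_single_one,
    Pi.sub_apply, col_apply] at this
  rw [this, hs]
  ring

/-- Two centered Gaussian vectors `X, Y` in `ℝⁿ` have the same `L²` metric
`d_X = d_Y` iff there is a centered Gaussian vector `(Z₁, …, Z_n, W)` in `ℝⁿ⁺¹`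
with `(Z₁, …, Z_n) ~ X` and `(Z₁ + W, …, Z_n + W) ~ Y`. -/
theorem same_metric_iff_common_shift (n : ℕ) (μX μY : Measure (Fin n → ℝ))
    (CX CY : Matrix (Fin n) (Fin n) ℝ)
    (hX : IsCenteredGaussian n μX CX) (hY : IsCenteredGaussian n μY CY) :
    (∀ i j, Real.sqrt (∫ x, (x i - x j) ^ 2 ∂μX)
        = Real.sqrt (∫ y, (y i - y j) ^ 2 ∂μY))
      ↔ ∃ (C : Matrix (Fin (n + 1)) (Fin (n + 1)) ℝ) (ν : Measure (Fin (n + 1) → ℝ)),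
          IsCenteredGaussian (n + 1) ν C ∧
          ν.map (fun v (i : Fin n) => v i.castSucc) = μX ∧
          ν.map (fun v (i : Fin n) => v i.castSucc + v (Fin.last n)) = μY := by
  constructor
  · intro h
    have hsq : ∀ i j, CX i i + CX j j - 2 * CX i j = CY i i + CY j j - 2 * CY i j := fun i j => by
      rw [← hX.integral_sub_sq, ← hY.integral_sub_sq]
      exact (Real.sqrt_inj (integral_nonneg fun _ => sq_nonneg _)
        (integral_nonneg fun _ => sq_nonneg _)).1 (h i j)
    obtain ⟨E, hE, hEX, hEY⟩ := hX.posSemidef.exists_extension hY.posSemidef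
      (a := fun i => (CY i i - CX i i) / 2) fun i j => by linarith [hsq i j]
    obtain ⟨A, rfl⟩ := hE.exists_eq_mul_transpose
    obtain ⟨AX, rfl, rfl⟩ := hX
    obtain ⟨AY, rfl, rfl⟩ := hY
    refine ⟨_, _, ⟨A, rfl, rfl⟩, ?_, ?_⟩
    · rw [Measure.map_map measurable_comp_castSucc (measurable_mulVec A)]
      change (stdGaussianPi (n + 1)).map (A.submatrix Fin.castSucc id).mulVec = _
      exact stdGaussianPi_map_mulVec_eq (Matrix.ext hEX)
    · rw [Measure.map_map measurable_comp_castSucc_add_last (measurable_mulVec A)]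
      have hcomp : (fun (v : Fin (n + 1) → ℝ) (i : Fin n) => v i.castSucc + v (Fin.last n)) ∘
          A.mulVec = (Matrix.of fun i k => A (Fin.castSucc i) k + A (Fin.last n) k).mulVec :=
        funext fun v => funext fun i => (add_dotProduct _ _ v).symm
      rw [hcomp]
      refine stdGaussianPi_map_mulVec_eq (Matrix.ext fun i j => ?_)
      rw [← hEY i j]
      simp only [Matrix.mul_apply, Matrix.of_apply, Matrix.transpose_apply,
        ← Finset.sum_add_distrib]
      exact Finset.sum_congr rfl fun k _ => by ring
  · rintro ⟨C, ν, -, rfl, rfl⟩ i j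
    rw [integral_map measurable_comp_castSucc.aemeasurable (by fun_prop),
      integral_map measurable_comp_castSucc_add_last.aemeasurable (by fun_prop)]
    simp only [add_sub_add_right_eq_sub]
end

section
/- Fix positive weights w₁,…,w_n > 0. Let X and Y be centered Gaussian random vectors in ℝⁿ with covariance matrices C^X and C^Y, and suppose d_X(i,j) = d_Y(i,j) for all i,j, where d_X(i,j) = √(E[(X_i − X_j)²]). Then E[log Σ_{i=1}ⁿ w_i e^{X_i}] = E[log Σ_{i=1}ⁿ w_i e^{Y_i}]. In other words, the function F(C) := E[log Σ_{i=1}ⁿ w_i e^{X_i}] on positive semidefinite covariance matrices depends only on the associated L² metric. -/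
open MeasureTheory ProbabilityTheory

instance isGaussian_stdGaussianPi (n : ℕ) : IsGaussian (stdGaussianPi n) := by
  have h : iIndepFun (fun (i : Fin n) (x : Fin n → ℝ) => x i) (stdGaussianPi n) :=
    iIndepFun_pi (X := fun _ => id) (fun _ => aemeasurable_id)
  have hi : ∀ i, HasGaussianLaw (fun x : Fin n → ℝ => x i) (stdGaussianPi n) := fun i =>
    ⟨by
      rw [stdGaussianPi, (measurePreserving_eval (fun _ : Fin n => gaussianReal 0 1) i).map_eq]
      infer_instance⟩
  simpa using (h.hasGaussianLaw hi).isGaussian_map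

lemma integral_eval_stdGaussianPi (n : ℕ) (i : Fin n) : ∫ x, x i ∂stdGaussianPi n = 0 := by
  have hp := measurePreserving_eval (fun _ : Fin n => gaussianReal 0 1) i
  have h := integral_map (μ := stdGaussianPi n) (φ := fun x => x i) (f := fun t : ℝ => t)
    (measurable_pi_apply i).aemeasurable (by fun_prop)
  rw [← h]
  change ∫ t, t ∂(stdGaussianPi n).map (Function.eval i) = 0
  rw [stdGaussianPi, hp.map_eq, integral_id_gaussianReal]

lemma dual_apply_eq_sum {n : ℕ} (L : StrongDual ℝ (Fin n → ℝ)) (x : Fin n → ℝ) :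
    L x = ∑ i, x i * L (Pi.single i 1) := by
  conv_lhs => rw [pi_eq_sum_univ' x]
  simp

lemma integral_dual_stdGaussianPi {n : ℕ} (L : StrongDual ℝ (Fin n → ℝ)) :
    ∫ x, L x ∂stdGaussianPi n = 0 := by
  have hint : ∀ i, Integrable (fun x : Fin n → ℝ => x i) (stdGaussianPi n) := fun i =>
    IsGaussian.integrable_dual _ (ContinuousLinearMap.proj (R := ℝ) (φ := fun _ : Fin n => ℝ) i)
  rw [integral_congr_ae (.of_forall (dual_apply_eq_sum L)),
    integral_finsetSum _ fun i _ => (hint i).mul_const _]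
  simp [integral_mul_const, integral_eval_stdGaussianPi]

namespace IsCenteredGaussian

variable {n : ℕ} {μ : Measure (Fin n → ℝ)} {C : Matrix (Fin n) (Fin n) ℝ}

lemma eq_map_clm (h : IsCenteredGaussian n μ C) :
    ∃ T : (Fin n → ℝ) →L[ℝ] (Fin n → ℝ), μ = (stdGaussianPi n).map T := by
  obtain ⟨A, -, hA⟩ := h
  exact ⟨A.mulVecLin.toContinuousLinearMap, hA⟩

lemma isGaussian (h : IsCenteredGaussian n μ C) : IsGaussian μ := by
  obtain ⟨T, rfl⟩ := h.eq_map_clm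
  infer_instance

lemma integral_dual (h : IsCenteredGaussian n μ C) (L : StrongDual ℝ (Fin n → ℝ)) :
    ∫ x, L x ∂μ = 0 := by
  obtain ⟨T, rfl⟩ := h.eq_map_clm
  rw [integral_map (by fun_prop) (by fun_prop)]
  exact integral_dual_stdGaussianPi (L.comp T)

lemma charFunDual_eq (h : IsCenteredGaussian n μ C) (L : StrongDual ℝ (Fin n → ℝ)) :
    charFunDual μ L = Complex.exp (-(∫ x, L x ^ 2 ∂μ : ℝ) / 2) := by
  have := h.isGaussian
  have h0 : (∫ x, (L x : ℂ) ∂μ) = 0 := by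
    rw [integral_complex_ofReal, h.integral_dual, Complex.ofReal_zero]
  rw [IsGaussian.charFunDual_eq, variance_of_integral_eq_zero (by fun_prop) (h.integral_dual L), h0]
  congr 1
  ring

end IsCenteredGaussian

lemma sq_sum_mul_of_sum_eq_zero {ι : Type*} [Fintype ι] (a x : ι → ℝ) (ha : ∑ i, a i = 0) :
    (∑ i, x i * a i) ^ 2 = ∑ i, ∑ j, -(a i * a j / 2) * (x i - x j) ^ 2 := by
  have hexp : ∀ i j, -(a i * a j / 2) * (x i - x j) ^ 2
      = (x i * a i) * (x j * a j) - (x i ^ 2 * a i / 2) * a j - a i * (x j ^ 2 * a j / 2) :=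
    fun i j => by ring
  simp_rw [hexp, Finset.sum_sub_distrib, ← Finset.mul_sum, ← Finset.sum_mul, ha]
  ring

/-- The second moment of a contrast, i.e. a linear form vanishing on constants, is determined by
the second moments of the increments. -/
lemma integral_sq_dual_of_apply_one_eq_zero {n : ℕ} (μ : Measure (Fin n → ℝ)) [IsGaussian μ]
    (L : StrongDual ℝ (Fin n → ℝ)) (hL : L 1 = 0) :
    ∫ x, L x ^ 2 ∂μ = ∑ i, ∑ j,
      -(L (Pi.single i 1) * L (Pi.single j 1) / 2) * ∫ x, (x i - x j) ^ 2 ∂μ := by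
  have ha : ∑ i, L (Pi.single i 1) = 0 := by
    rw [← hL, dual_apply_eq_sum L 1]
    simp
  have hint : ∀ i j, Integrable (fun x : Fin n → ℝ => (x i - x j) ^ 2) μ := fun i j =>
    (IsGaussian.memLp_dual μ
      (ContinuousLinearMap.proj (R := ℝ) (φ := fun _ : Fin n => ℝ) i -
        ContinuousLinearMap.proj (R := ℝ) (φ := fun _ : Fin n => ℝ) j) 2 (by simp)).integrable_sq
  have hexp : ∀ x, L x ^ 2 = ∑ i, ∑ j,
      -(L (Pi.single i 1) * L (Pi.single j 1) / 2) * (x i - x j) ^ 2 := fun x => by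
    rw [dual_apply_eq_sum L x, sq_sum_mul_of_sum_eq_zero _ _ ha]
  simp_rw [hexp]
  rw [integral_finsetSum _ fun i _ => integrable_finsetSum _ fun j _ => (hint i j).const_mul _]
  refine Finset.sum_congr rfl fun i _ => ?_
  rw [integral_finsetSum _ fun j _ => (hint i j).const_mul _]
  simp_rw [integral_const_mul]

/-- Subtraction of the coordinate `k` from all coordinates. -/
noncomputable def subCoord {n : ℕ} (k : Fin n) : (Fin n → ℝ) →L[ℝ] (Fin n → ℝ) :=
  ContinuousLinearMap.pi fun i =>
    ContinuousLinearMap.proj (R := ℝ) (φ := fun _ : Fin n => ℝ) i -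
      ContinuousLinearMap.proj (R := ℝ) (φ := fun _ : Fin n => ℝ) k

@[simp]
lemma subCoord_apply {n : ℕ} (k : Fin n) (x : Fin n → ℝ) (i : Fin n) :
    subCoord k x i = x i - x k := rfl

lemma map_subCoord_eq {n : ℕ} {μ ν : Measure (Fin n → ℝ)} {C D : Matrix (Fin n) (Fin n) ℝ}
    (hμ : IsCenteredGaussian n μ C) (hν : IsCenteredGaussian n ν D)
    (h : ∀ i j, ∫ x, (x i - x j) ^ 2 ∂μ = ∫ x, (x i - x j) ^ 2 ∂ν) (k : Fin n) :
    μ.map (subCoord k) = ν.map (subCoord k) := by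
  have := hμ.isGaussian
  have := hν.isGaussian
  refine Measure.ext_of_charFunDual ?_
  ext L
  have h1 : L.comp (subCoord k) 1 = 0 := by
    have : subCoord k 1 = 0 := by
      ext i
      simp
    simp [this]
  rw [charFunDual_map, charFunDual_map, hμ.charFunDual_eq, hν.charFunDual_eq,
    integral_sq_dual_of_apply_one_eq_zero μ _ h1, integral_sq_dual_of_apply_one_eq_zero ν _ h1]
  simp_rw [h]

lemma log_sum_mul_exp_eq_add {n : ℕ} (w : Fin n → ℝ) (hw : ∀ i, 0 < w i) (k : Fin n)
    (x : Fin n → ℝ) :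
    Real.log (∑ i, w i * Real.exp (x i))
      = x k + Real.log (∑ i, w i * Real.exp (subCoord k x i)) := by
  have hpos : 0 < ∑ i, w i * Real.exp (subCoord k x i) :=
    Finset.sum_pos (fun i _ => mul_pos (hw i) (Real.exp_pos _)) ⟨k, Finset.mem_univ k⟩
  conv_rhs => rw [← Real.log_exp (x k)]
  rw [← Real.log_mul (Real.exp_pos _).ne' hpos.ne', Finset.mul_sum]
  congr 1
  refine Finset.sum_congr rfl fun i _ => ?_
  rw [mul_left_comm, ← Real.exp_add, subCoord_apply, add_sub_cancel]

lemma IsCenteredGaussian.integral_log_sum_mul_exp {n : ℕ} {μ : Measure (Fin n → ℝ)}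
    {C : Matrix (Fin n) (Fin n) ℝ} (hμ : IsCenteredGaussian n μ C)
    (w : Fin n → ℝ) (hw : ∀ i, 0 < w i) (k : Fin n) :
    ∫ x, Real.log (∑ i, w i * Real.exp (x i)) ∂μ
      = ∫ x, Real.log (∑ i, w i * Real.exp (x i)) ∂μ.map (subCoord k) := by
  have := hμ.isGaussian
  have hmeas : Measurable fun x : Fin n → ℝ => Real.log (∑ i, w i * Real.exp (x i)) := by
    fun_prop
  have hint : Integrable (fun x : Fin n → ℝ => x k) μ :=
    IsGaussian.integrable_dual _ (ContinuousLinearMap.proj (R := ℝ) (φ := fun _ : Fin n => ℝ) k)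
  have h0 : ∫ x, x k ∂μ = 0 :=
    hμ.integral_dual (ContinuousLinearMap.proj (R := ℝ) (φ := fun _ : Fin n => ℝ) k)
  rw [integral_map (by fun_prop) hmeas.aestronglyMeasurable]
  rw [integral_congr_ae (.of_forall fun x => log_sum_mul_exp_eq_add w hw k x)]
  by_cases hg : Integrable
      (fun x => Real.log (∑ i, w i * Real.exp (subCoord k x i))) μ
  · rw [integral_add hint hg, h0, zero_add]
  · rw [integral_undef hg, integral_undef]
    exact fun h => hg ((integrable_add_iff_integrable_right' hint).1 h)

/-- The quenched functional `F(C) = E[log Σᵢ wᵢ e^{Xᵢ}]` depends on a centered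
Gaussian vector only through its `L²` metric: if `d_X = d_Y` then the two
expectations coincide. -/
theorem free_energy_depends_only_on_metric (n : ℕ)
    (μX μY : Measure (Fin n → ℝ)) (CX CY : Matrix (Fin n) (Fin n) ℝ)
    (hX : IsCenteredGaussian n μX CX) (hY : IsCenteredGaussian n μY CY)
    (w : Fin n → ℝ) (hw : ∀ i, 0 < w i)
    (hd : ∀ i j, Real.sqrt (∫ x, (x i - x j) ^ 2 ∂μX)
        = Real.sqrt (∫ y, (y i - y j) ^ 2 ∂μY)) :
    (∫ x, Real.log (∑ i, w i * Real.exp (x i)) ∂μX)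
      = ∫ y, Real.log (∑ i, w i * Real.exp (y i)) ∂μY := by
  rcases isEmpty_or_nonempty (Fin n) with _ | ⟨⟨k⟩⟩
  · simp
  have h : ∀ i j, ∫ x, (x i - x j) ^ 2 ∂μX = ∫ x, (x i - x j) ^ 2 ∂μY := fun i j =>
    (Real.sqrt_inj (integral_nonneg fun _ => sq_nonneg _)
      (integral_nonneg fun _ => sq_nonneg _)).1 (hd i j)
  rw [hX.integral_log_sum_mul_exp w hw k, hY.integral_log_sum_mul_exp w hw k,
    map_subCoord_eq hX hY h k]
end

section
/- Let X and Y be centered Gaussian random vectors in ℝⁿ. Fix positive weights w₁,…,w_n > 0 and let f(x) = log Σ_{i=1}ⁿ w_i e^{x_i}. If d_Y(i,j) ≥ d_X(i,j) for all i,j, where d_X(i,j) = √(E[(X_i − X_j)²]) and d_Y(i,j) = √(E[(Y_i − Y_j)²]), then E[f(Y)] ≥ E[f(X)]. -/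
open MeasureTheory ProbabilityTheory

open scoped Matrix

section GaussianIntegrationByParts

lemma hasDerivAt_gaussianPDFReal_zero_one (x : ℝ) :
    HasDerivAt (gaussianPDFReal 0 1) (-(x * gaussianPDFReal 0 1 x)) x := by
  rw [gaussianPDFReal_def]
  have h : HasDerivAt (fun y : ℝ => -(y - 0) ^ 2 / (2 * ((1 : NNReal) : ℝ))) (-x) x := by
    have := (((hasDerivAt_id x).sub_const 0).pow 2).neg.div_const (2 * ((1 : NNReal) : ℝ))
    refine this.congr_deriv ?_
    simp
    ring
  refine (h.exp.const_mul _).congr_deriv ?_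
  ring

lemma integrable_gaussianReal_iff {f : ℝ → ℝ} :
    Integrable f (gaussianReal 0 1) ↔ Integrable fun x => gaussianPDFReal 0 1 x * f x := by
  rw [gaussianReal_of_var_ne_zero 0 one_ne_zero,
    integrable_withDensity_iff_integrable_smul' (measurable_gaussianPDF _ _)
      (ae_of_all _ fun _ => gaussianPDF_lt_top)]
  simp

/-- Gaussian integration by parts (Stein's identity) on the line. -/
lemma integral_mul_gaussianReal_eq_integral_deriv {f f' : ℝ → ℝ}
    (hf : ∀ x, HasDerivAt f (f' x) x)
    (hi : Integrable f (gaussianReal 0 1)) (hi' : Integrable f' (gaussianReal 0 1))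
    (hxi : Integrable (fun x => x * f x) (gaussianReal 0 1)) :
    ∫ x, x * f x ∂(gaussianReal 0 1) = ∫ x, f' x ∂(gaussianReal 0 1) := by
  rw [integrable_gaussianReal_iff] at hi hi' hxi
  have key := integral_mul_deriv_eq_deriv_mul_of_integrable
    (fun x _ => hf x) (fun x _ => hasDerivAt_gaussianPDFReal_zero_one x)
    (hxi.neg.congr (ae_of_all _ fun x => by simp; ring))
    (hi'.congr (ae_of_all _ fun x => by simp; ring))
    (hi.congr (ae_of_all _ fun x => by simp; ring))
  rw [integral_gaussianReal_eq_integral_smul one_ne_zero,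
    integral_gaussianReal_eq_integral_smul one_ne_zero]
  calc ∫ x, gaussianPDFReal 0 1 x • (x * f x)
      = -∫ x, f x * -(x * gaussianPDFReal 0 1 x) := by
        rw [← integral_neg]; congr 1; ext x; simp; ring
    _ = ∫ x, gaussianPDFReal 0 1 x • f' x := by
        rw [key, neg_neg]; congr 1; ext x; simp; ring

variable {ι : Type*} [Fintype ι] [DecidableEq ι]

/-- Resampling one coordinate of a product probability measure preserves the measure. -/
lemma measurePreserving_update {X : ι → Type*} [∀ i, MeasurableSpace (X i)]
    (μ : ∀ i, Measure (X i)) [∀ i, IsProbabilityMeasure (μ i)] (k : ι) :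
    MeasurePreserving (fun q : (∀ i, X i) × X k => Function.update q.1 k q.2)
      ((Measure.pi μ).prod (μ k)) (Measure.pi μ) := by
  have hm : Measurable fun q : (∀ i, X i) × X k => Function.update q.1 k q.2 :=
    measurable_update'
  refine ⟨hm, (Measure.pi_eq fun s hs => ?_).symm⟩
  rw [Measure.map_apply hm (MeasurableSet.univ_pi hs)]
  have : (fun q : (∀ i, X i) × X k => Function.update q.1 k q.2) ⁻¹' Set.univ.pi s
      = Set.univ.pi (Function.update s k Set.univ) ×ˢ s k := by
    ext ⟨g, t⟩
    simp only [Set.mem_preimage, Set.mem_univ_pi, Set.mem_prod]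
    constructor
    · refine fun h => ⟨fun i => ?_, by simpa using h k⟩
      by_cases hik : i = k
      · subst hik; simp
      · simpa [hik] using h i
    · rintro ⟨h, ht⟩ i
      by_cases hik : i = k
      · subst hik; simpa using ht
      · simpa [hik] using h i
  rw [this, Measure.prod_prod, Measure.pi_pi, ← Finset.prod_erase_mul _ _ (Finset.mem_univ k),
    ← Finset.prod_erase_mul _ (fun i => μ i (s i)) (Finset.mem_univ k)]
  simp only [Function.update_self, measure_univ, mul_one]
  congr 1
  refine Finset.prod_congr rfl fun i hi => ?_
  rw [Function.update_of_ne (Finset.ne_of_mem_erase hi)]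

/-- Gaussian integration by parts in one coordinate of a standard Gaussian vector. -/
lemma integral_eval_mul_pi_gaussianReal {F F' : (ι → ℝ) → ℝ} (k : ι)
    (hF : ∀ g t, HasDerivAt (fun s => F (Function.update g k s)) (F' (Function.update g k t)) t)
    (hi : Integrable F (Measure.pi fun _ => gaussianReal 0 1))
    (hi' : Integrable F' (Measure.pi fun _ => gaussianReal 0 1))
    (hxi : Integrable (fun g => g k * F g) (Measure.pi fun _ => gaussianReal 0 1)) :
    ∫ g, g k * F g ∂(Measure.pi fun _ => gaussianReal 0 1)
      = ∫ g, F' g ∂(Measure.pi fun _ => gaussianReal 0 1) := by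
  have hu := measurePreserving_update (fun _ : ι => gaussianReal 0 1) k
  have fubini : ∀ {H : (ι → ℝ) → ℝ}, Integrable H (Measure.pi fun _ => gaussianReal 0 1) →
      ∫ g, H g ∂(Measure.pi fun _ => gaussianReal 0 1)
        = ∫ g, ∫ t, H (Function.update g k t) ∂(gaussianReal 0 1)
            ∂(Measure.pi fun _ => gaussianReal 0 1) := by
    intro H hH
    have hHu := hu.integrable_comp_of_integrable hH
    have h := integral_prod _ hHu
    simp only [Function.comp_def] at h
    rw [← h, ← integral_map hu.measurable.aemeasurable
      (by rw [hu.map_eq]; exact hH.aestronglyMeasurable), hu.map_eq]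
  rw [fubini hxi, fubini hi']
  have h := (hu.integrable_comp_of_integrable hi).prod_right_ae
  have h' := (hu.integrable_comp_of_integrable hi').prod_right_ae
  have hx := (hu.integrable_comp_of_integrable hxi).prod_right_ae
  refine integral_congr_ae ?_
  filter_upwards [h, h', hx] with g hg hg' hgx
  simp only [Function.comp_def, Function.update_self] at hg hg' hgx ⊢
  exact integral_mul_gaussianReal_eq_integral_deriv (hF g) hg hg' hgx

omit [DecidableEq ι] in
lemma memLp_eval_pi_gaussianReal (k : ι) :
    MemLp (fun g : ι → ℝ => g k) 2 (Measure.pi fun _ => gaussianReal 0 1) :=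
  (memLp_id_gaussianReal' 2 (by simp)).comp_measurePreserving
    (measurePreserving_eval (fun _ : ι => gaussianReal 0 1) k)

lemma hasDerivAt_dotProduct_update (c g : ι → ℝ) (k : ι) (t : ℝ) :
    HasDerivAt (fun s => c ⬝ᵥ Function.update g k s) (c k) t := by
  have h : HasDerivAt (fun s => ∑ i, c i * Function.update g k s i)
      (∑ i, c i * (Pi.single k (1 : ℝ) : ι → ℝ) i) t := by
    refine HasDerivAt.fun_sum fun i _ => HasDerivAt.const_mul _ ?_
    exact hasDerivAt_pi.1 (hasDerivAt_update g k t) i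
  simpa [dotProduct, Pi.single_apply] using h

omit [DecidableEq ι] in
lemma memLp_dotProduct_pi_gaussianReal (c : ι → ℝ) :
    MemLp (fun g : ι → ℝ => c ⬝ᵥ g) 2 (Measure.pi fun _ => gaussianReal 0 1) := by
  simp only [dotProduct]
  exact memLp_finsetSum _ fun k _ => (memLp_eval_pi_gaussianReal k).const_mul (c k)

lemma integral_dotProduct_sq_pi_gaussianReal (c : ι → ℝ) :
    ∫ g, (c ⬝ᵥ g) ^ 2 ∂(Measure.pi fun _ => gaussianReal 0 1) = ∑ k, c k ^ 2 := by
  have hc := memLp_dotProduct_pi_gaussianReal c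
  have hi : ∀ k, Integrable (fun g : ι → ℝ => g k * (c ⬝ᵥ g))
      (Measure.pi fun _ => gaussianReal 0 1) := fun k =>
    (memLp_eval_pi_gaussianReal k).integrable_mul hc
  have hk : ∀ k, ∫ g, g k * (c ⬝ᵥ g) ∂(Measure.pi fun _ => gaussianReal 0 1) = c k := by
    intro k
    rw [integral_eval_mul_pi_gaussianReal (F' := fun _ => c k) k
      (fun g t => hasDerivAt_dotProduct_update c g k t) (hc.integrable one_le_two)
      (integrable_const _) (hi k)]
    simp
  calc ∫ g, (c ⬝ᵥ g) ^ 2 ∂(Measure.pi fun _ => gaussianReal 0 1)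
      = ∫ g, ∑ k, c k * (g k * (c ⬝ᵥ g)) ∂(Measure.pi fun _ => gaussianReal 0 1) := by
        congr 1; ext g
        rw [sq]
        nth_rewrite 1 [dotProduct]
        rw [Finset.sum_mul]
        exact Finset.sum_congr rfl fun k _ => by ring
    _ = ∑ k, c k ^ 2 := by
        rw [integral_finsetSum _ fun k _ => (hi k).const_mul _]
        exact Finset.sum_congr rfl fun k _ => by rw [integral_const_mul, hk, sq]

end GaussianIntegrationByParts

section LogSumExp

variable {κ : Type*} [Fintype κ]

/-- The weighted log-sum-exp function `x ↦ log ∑ᵢ wᵢ e^{xᵢ}`. -/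
noncomputable def logSumExp (w x : κ → ℝ) : ℝ := Real.log (∑ i, w i * Real.exp (x i))

/-- The Gibbs weights `wᵢ e^{xᵢ} / ∑ⱼ wⱼ e^{xⱼ}`, i.e. the gradient of `logSumExp w`. -/
noncomputable def gibbsWeight (w x : κ → ℝ) (i : κ) : ℝ :=
  w i * Real.exp (x i) / ∑ j, w j * Real.exp (x j)

variable {w : κ → ℝ}

lemma gibbsWeight_nonneg (hw : ∀ i, 0 < w i) (x : κ → ℝ) (i : κ) : 0 ≤ gibbsWeight w x i :=
  div_nonneg (mul_nonneg (hw i).le (Real.exp_pos _).le)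
    (Finset.sum_nonneg fun j _ => mul_nonneg (hw j).le (Real.exp_pos _).le)

variable [Nonempty κ]

lemma sum_mul_exp_pos (hw : ∀ i, 0 < w i) (x : κ → ℝ) : 0 < ∑ i, w i * Real.exp (x i) :=
  Finset.sum_pos (fun i _ => mul_pos (hw i) (Real.exp_pos _)) Finset.univ_nonempty

lemma sum_gibbsWeight (hw : ∀ i, 0 < w i) (x : κ → ℝ) : ∑ i, gibbsWeight w x i = 1 := by
  simp only [gibbsWeight]
  rw [← Finset.sum_div, div_self (sum_mul_exp_pos hw x).ne']

lemma gibbsWeight_le_one (hw : ∀ i, 0 < w i) (x : κ → ℝ) (i : κ) : gibbsWeight w x i ≤ 1 :=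
  sum_gibbsWeight hw x ▸
    Finset.single_le_sum (fun j _ => gibbsWeight_nonneg hw x j) (Finset.mem_univ i)

lemma abs_gibbsWeight_le_one (hw : ∀ i, 0 < w i) (x : κ → ℝ) (i : κ) : |gibbsWeight w x i| ≤ 1 := by
  rw [abs_of_nonneg (gibbsWeight_nonneg hw x i)]
  exact gibbsWeight_le_one hw x i

lemma continuous_logSumExp (hw : ∀ i, 0 < w i) : Continuous (logSumExp w) := by
  unfold logSumExp
  exact Continuous.log (by fun_prop) fun x => (sum_mul_exp_pos hw x).ne'

lemma continuous_gibbsWeight (hw : ∀ i, 0 < w i) (i : κ) :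
    Continuous fun x => gibbsWeight w x i := by
  unfold gibbsWeight
  exact Continuous.div (by fun_prop) (by fun_prop) fun x => (sum_mul_exp_pos hw x).ne'

omit [Nonempty κ] in
lemma hasDerivAt_sum_mul_exp {x : ℝ → κ → ℝ} {x' : κ → ℝ} {t : ℝ}
    (hx : ∀ i, HasDerivAt (fun s => x s i) (x' i) t) :
    HasDerivAt (fun s => ∑ i, w i * Real.exp (x s i)) (∑ i, w i * Real.exp (x t i) * x' i) t :=
  HasDerivAt.fun_sum fun i _ => ((hx i).exp.const_mul (w i)).congr_deriv (by ring)

lemma hasDerivAt_logSumExp (hw : ∀ i, 0 < w i) {x : ℝ → κ → ℝ} {x' : κ → ℝ} {t : ℝ}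
    (hx : ∀ i, HasDerivAt (fun s => x s i) (x' i) t) :
    HasDerivAt (fun s => logSumExp w (x s)) (∑ i, gibbsWeight w (x t) i * x' i) t := by
  refine ((hasDerivAt_sum_mul_exp hx).log (sum_mul_exp_pos hw _).ne').congr_deriv ?_
  rw [Finset.sum_div]
  exact Finset.sum_congr rfl fun i _ => by rw [gibbsWeight]; ring

lemma hasDerivAt_gibbsWeight (hw : ∀ i, 0 < w i) {x : ℝ → κ → ℝ} {x' : κ → ℝ} {t : ℝ}
    (hx : ∀ i, HasDerivAt (fun s => x s i) (x' i) t) (i : κ) :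
    HasDerivAt (fun s => gibbsWeight w (x s) i)
      (gibbsWeight w (x t) i * (x' i - ∑ j, gibbsWeight w (x t) j * x' j)) t := by
  have hS := (sum_mul_exp_pos hw (x t)).ne'
  refine (((hx i).exp.const_mul (w i)).div (hasDerivAt_sum_mul_exp hx) hS).congr_deriv ?_
  have : ∑ j, gibbsWeight w (x t) j * x' j
      = (∑ j, w j * Real.exp (x t j) * x' j) / ∑ j, w j * Real.exp (x t j) := by
    rw [Finset.sum_div]
    exact Finset.sum_congr rfl fun j _ => by rw [gibbsWeight]; ring
  rw [this, gibbsWeight]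
  field_simp

lemma abs_logSumExp_le (hw : ∀ i, 0 < w i) (x : κ → ℝ) :
    |logSumExp w x| ≤ |Real.log (∑ i, w i)| + ∑ i, |x i| := by
  have hW : 0 < ∑ i, w i := Finset.sum_pos (fun i _ => hw i) Finset.univ_nonempty
  have hle : ∀ i, |x i| ≤ ∑ j, |x j| := fun i =>
    Finset.single_le_sum (f := fun j => |x j|) (fun j _ => abs_nonneg _) (Finset.mem_univ i)
  have hlog : ∀ s : ℝ, Real.log (∑ i, w i * Real.exp s) = Real.log (∑ i, w i) + s := fun s => by
    rw [← Finset.sum_mul, Real.log_mul hW.ne' (Real.exp_pos s).ne', Real.log_exp]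
  have upper : logSumExp w x ≤ Real.log (∑ i, w i) + ∑ i, |x i| := by
    rw [← hlog]
    refine Real.log_le_log (sum_mul_exp_pos hw x) (Finset.sum_le_sum fun i _ => ?_)
    exact mul_le_mul_of_nonneg_left (Real.exp_le_exp.2 ((le_abs_self _).trans (hle i))) (hw i).le
  have lower : Real.log (∑ i, w i) + -∑ i, |x i| ≤ logSumExp w x := by
    rw [← hlog]
    refine Real.log_le_log (sum_mul_exp_pos hw fun _ => _) (Finset.sum_le_sum fun i _ => ?_)
    exact mul_le_mul_of_nonneg_left
      (Real.exp_le_exp.2 ((neg_le_neg (hle i)).trans (neg_abs_le _))) (hw i).le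
  rw [abs_le]
  constructor
  · linarith [neg_abs_le (Real.log (∑ i, w i))]
  · linarith [le_abs_self (Real.log (∑ i, w i))]

end LogSumExp

/-- The covariance of two functions on a finite probability space, as a sum over pairs. -/
lemma sum_mul_mul_sub_sum_eq_half_sum {κ : Type*} [Fintype κ] {p : κ → ℝ} (hp : ∑ i, p i = 1)
    (a b : κ → ℝ) :
    ∑ i, p i * (a i * (b i - ∑ j, p j * b j))
      = 1 / 2 * ∑ i, ∑ j, p i * p j * ((a i - a j) * (b i - b j)) := by
  have h1 : ∑ i, ∑ j, p i * p j * ((a i - a j) * (b i - b j))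
      = (∑ i, p i * (a i * b i)) * ∑ j, p j - (∑ i, p i * a i) * ∑ j, p j * b j
        - (∑ i, p i * b i) * (∑ j, p j * a j) + (∑ i, p i) * ∑ j, p j * (a j * b j) := by
    simp only [Finset.sum_mul_sum, ← Finset.sum_sub_distrib, ← Finset.sum_add_distrib]
    exact Finset.sum_congr rfl fun i _ => Finset.sum_congr rfl fun j _ => by ring
  have h2 : ∑ i, p i * (a i * (b i - ∑ j, p j * b j))
      = ∑ i, p i * (a i * b i) - (∑ i, p i * a i) * ∑ j, p j * b j := by
    rw [Finset.sum_mul, ← Finset.sum_sub_distrib]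
    exact Finset.sum_congr rfl fun i _ => by ring
  rw [h1, h2, hp]
  ring

section Interpolation

variable {κ ι : Type*} [Fintype κ] [Nonempty κ] [Fintype ι] {w : κ → ℝ}

lemma integrable_dotProduct_pi_gaussianReal (c : ι → ℝ) :
    Integrable (fun g : ι → ℝ => c ⬝ᵥ g) (Measure.pi fun _ => gaussianReal 0 1) :=
  (memLp_dotProduct_pi_gaussianReal c).integrable one_le_two

lemma continuous_gibbsWeight_mulVec (hw : ∀ i, 0 < w i) (M : Matrix κ ι ℝ) (i : κ) :
    Continuous fun g => gibbsWeight w (M *ᵥ g) i :=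
  (continuous_gibbsWeight hw i).comp (continuous_const.matrix_mulVec continuous_id)

lemma integrable_gibbsWeight_mulVec_mul (hw : ∀ i, 0 < w i) (M : Matrix κ ι ℝ) (i : κ)
    {F : (ι → ℝ) → ℝ} (hF : Integrable F (Measure.pi fun _ => gaussianReal 0 1)) :
    Integrable (fun g => gibbsWeight w (M *ᵥ g) i * F g)
      (Measure.pi fun _ => gaussianReal 0 1) :=
  hF.bdd_mul (c := 1) (continuous_gibbsWeight_mulVec hw M i).aestronglyMeasurable
    (ae_of_all _ fun _ => abs_gibbsWeight_le_one hw _ i)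

lemma integrable_gibbsWeight_mulVec (hw : ∀ i, 0 < w i) (M : Matrix κ ι ℝ) (i : κ) :
    Integrable (fun g => gibbsWeight w (M *ᵥ g) i) (Measure.pi fun _ => gaussianReal 0 1) := by
  simpa using integrable_gibbsWeight_mulVec_mul hw M i (integrable_const (1 : ℝ))

lemma integrable_logSumExp_mulVec (hw : ∀ i, 0 < w i) (M : Matrix κ ι ℝ) :
    Integrable (fun g => logSumExp w (M *ᵥ g)) (Measure.pi fun _ => gaussianReal 0 1) := by
  refine Integrable.mono' (g := fun g => |Real.log (∑ i, w i)| + ∑ i, |(M *ᵥ g) i|) ?_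
    ((continuous_logSumExp hw).comp
      (continuous_const.matrix_mulVec continuous_id)).aestronglyMeasurable
    (ae_of_all _ fun g => abs_logSumExp_le hw _)
  exact (integrable_const _).add
    (integrable_finsetSum _ fun i _ => (integrable_dotProduct_pi_gaussianReal (M i)).abs)

lemma integral_eval_mul_gibbsWeight [DecidableEq ι] (hw : ∀ i, 0 < w i) (M : Matrix κ ι ℝ)
    (i : κ) (k : ι) :
    ∫ g, g k * gibbsWeight w (M *ᵥ g) i ∂(Measure.pi fun _ => gaussianReal 0 1)
      = ∫ g, gibbsWeight w (M *ᵥ g) i * (M i k - ∑ j, gibbsWeight w (M *ᵥ g) j * M j k)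
          ∂(Measure.pi fun _ => gaussianReal 0 1) := by
  refine integral_eval_mul_pi_gaussianReal k (F := fun g => gibbsWeight w (M *ᵥ g) i)
    (F' := fun g => gibbsWeight w (M *ᵥ g) i * (M i k - ∑ j, gibbsWeight w (M *ᵥ g) j * M j k))
    (fun g t => ?_) (integrable_gibbsWeight_mulVec hw M i) ?_ ?_
  · exact hasDerivAt_gibbsWeight hw (x := fun s => M *ᵥ Function.update g k s)
      (fun j => hasDerivAt_dotProduct_update (M j) g k t) i
  · exact integrable_gibbsWeight_mulVec_mul hw M i ((integrable_const _).sub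
      (integrable_finsetSum _ fun j _ => (integrable_gibbsWeight_mulVec hw M j).mul_const _))
  · exact (integrable_gibbsWeight_mulVec_mul hw M i
      ((memLp_eval_pi_gaussianReal k).integrable one_le_two)).congr
      (ae_of_all _ fun g => mul_comm _ _)

/-- Integration by parts for the derivative of `logSumExp` along a Gaussian interpolation. -/
lemma integral_sum_gibbsWeight_mul_mulVec (hw : ∀ i, 0 < w i) (M N : Matrix κ ι ℝ) :
    ∫ g, ∑ i, gibbsWeight w (M *ᵥ g) i * (N *ᵥ g) i ∂(Measure.pi fun _ => gaussianReal 0 1)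
      = ∫ g, 1 / 2 * ∑ i, ∑ j, gibbsWeight w (M *ᵥ g) i * gibbsWeight w (M *ᵥ g) j *
          ∑ k, (N i k - N j k) * (M i k - M j k) ∂(Measure.pi fun _ => gaussianReal 0 1) := by
  classical
  have hx : ∀ i k, Integrable (fun g : ι → ℝ => g k * gibbsWeight w (M *ᵥ g) i)
      (Measure.pi fun _ => gaussianReal 0 1) := fun i k =>
    (integrable_gibbsWeight_mulVec_mul hw M i
      ((memLp_eval_pi_gaussianReal k).integrable one_le_two)).congr
      (ae_of_all _ fun g => mul_comm _ _)
  have hy : ∀ i k, Integrable (fun g : ι → ℝ => gibbsWeight w (M *ᵥ g) i *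
      (M i k - ∑ j, gibbsWeight w (M *ᵥ g) j * M j k))
      (Measure.pi fun _ => gaussianReal 0 1) := fun i k =>
    integrable_gibbsWeight_mulVec_mul hw M i ((integrable_const _).sub
      (integrable_finsetSum _ fun j _ => (integrable_gibbsWeight_mulVec hw M j).mul_const _))
  calc ∫ g, ∑ i, gibbsWeight w (M *ᵥ g) i * (N *ᵥ g) i ∂(Measure.pi fun _ => gaussianReal 0 1)
      = ∫ g, ∑ i, ∑ k, N i k * (g k * gibbsWeight w (M *ᵥ g) i)
          ∂(Measure.pi fun _ => gaussianReal 0 1) := by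
        congr 1; ext g
        refine Finset.sum_congr rfl fun i _ => ?_
        simp only [Matrix.mulVec, dotProduct, Finset.mul_sum]
        exact Finset.sum_congr rfl fun k _ => by ring
    _ = ∫ g, ∑ i, ∑ k, N i k * (gibbsWeight w (M *ᵥ g) i *
          (M i k - ∑ j, gibbsWeight w (M *ᵥ g) j * M j k))
          ∂(Measure.pi fun _ => gaussianReal 0 1) := by
        refine (integral_finsetSum _ fun i _ => integrable_finsetSum _ fun k _ =>
            (hx i k).const_mul _).trans (Eq.trans ?_ (integral_finsetSum _ fun i _ =>
            integrable_finsetSum _ fun k _ => (hy i k).const_mul _).symm)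
        refine Finset.sum_congr rfl fun i _ => ?_
        refine (integral_finsetSum _ fun k _ => (hx i k).const_mul _).trans
          (Eq.trans ?_ (integral_finsetSum _ fun k _ => (hy i k).const_mul _).symm)
        refine Finset.sum_congr rfl fun k _ => ?_
        rw [integral_const_mul, integral_const_mul, integral_eval_mul_gibbsWeight hw]
    _ = _ := by
        congr 1; ext g
        have h := fun k => sum_mul_mul_sub_sum_eq_half_sum (sum_gibbsWeight hw (M *ᵥ g))
          (fun i => N i k) (fun i => M i k)
        rw [Finset.sum_comm]
        calc _ = ∑ k, ∑ i, gibbsWeight w (M *ᵥ g) i *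
              (N i k * (M i k - ∑ j, gibbsWeight w (M *ᵥ g) j * M j k)) :=
              Finset.sum_congr rfl fun k _ => Finset.sum_congr rfl fun i _ => by ring
          _ = _ := by
            simp only [h, Finset.mul_sum]
            rw [Finset.sum_comm]
            refine Finset.sum_congr rfl fun i _ => ?_
            rw [Finset.sum_comm]

/-- Differentiation under the expectation of `logSumExp` along a Gaussian interpolation. -/
lemma hasDerivAt_integral_logSumExp_mulVec (hw : ∀ i, 0 < w i) {M M' : ℝ → Matrix κ ι ℝ}
    {C : Matrix κ ι ℝ} (hM : ∀ t i k, HasDerivAt (fun s => M s i k) (M' t i k) t)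
    (hC : ∀ t i k, |M' t i k| ≤ C i k) (t : ℝ) :
    HasDerivAt (fun s => ∫ g, logSumExp w (M s *ᵥ g) ∂(Measure.pi fun _ => gaussianReal 0 1))
      (∫ g, ∑ i, gibbsWeight w (M t *ᵥ g) i * (M' t *ᵥ g) i
        ∂(Measure.pi fun _ => gaussianReal 0 1)) t := by
  refine (hasDerivAt_integral_of_dominated_loc_of_deriv_le
    (F := fun s g => logSumExp w (M s *ᵥ g))
    (F' := fun s g => ∑ i, gibbsWeight w (M s *ᵥ g) i * (M' s *ᵥ g) i)
    (bound := fun g => ∑ i, ∑ k, C i k * |g k|) Filter.univ_mem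
    (Filter.Eventually.of_forall fun s => (integrable_logSumExp_mulVec hw _).aestronglyMeasurable)
    (integrable_logSumExp_mulVec hw _) ?_ (ae_of_all _ fun g s _ => ?_) ?_
    (ae_of_all _ fun g s _ => hasDerivAt_logSumExp hw fun i => ?_)).2
  · exact (integrable_finsetSum _ fun i _ => integrable_gibbsWeight_mulVec_mul hw (M t) i
      (integrable_dotProduct_pi_gaussianReal (M' t i))).aestronglyMeasurable
  · refine (Finset.abs_sum_le_sum_abs _ _).trans (Finset.sum_le_sum fun i _ => ?_)
    rw [abs_mul]
    refine (mul_le_of_le_one_left (abs_nonneg _) (abs_gibbsWeight_le_one hw _ i)).trans ?_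
    refine (Finset.abs_sum_le_sum_abs _ _).trans (Finset.sum_le_sum fun k _ => ?_)
    rw [abs_mul]
    exact mul_le_mul_of_nonneg_right (hC s i k) (abs_nonneg _)
  · exact integrable_finsetSum _ fun i _ => integrable_finsetSum _ fun k _ =>
      (((memLp_eval_pi_gaussianReal k).integrable one_le_two).abs).const_mul _
  · exact HasDerivAt.fun_sum fun k _ => (hM s i k).mul_const _

/-- Comparison of the expected `logSumExp` of linear images of standard Gaussian vectors. -/
lemma integral_logSumExp_mulVec_le {ι' : Type*} [Fintype ι'] (hw : ∀ i, 0 < w i)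
    (A : Matrix κ ι ℝ) (B : Matrix κ ι' ℝ)
    (h : ∀ i j, ∑ k, (A i k - A j k) ^ 2 ≤ ∑ k, (B i k - B j k) ^ 2) :
    ∫ g, logSumExp w (A *ᵥ g) ∂(Measure.pi fun _ => gaussianReal 0 1)
      ≤ ∫ g, logSumExp w (B *ᵥ g) ∂(Measure.pi fun _ => gaussianReal 0 1) := by
  let M : ℝ → Matrix κ (ι ⊕ ι') ℝ := fun t => Matrix.fromCols (Real.cos t • A) (Real.sin t • B)
  let M' : ℝ → Matrix κ (ι ⊕ ι') ℝ := fun t => Matrix.fromCols (-Real.sin t • A) (Real.cos t • B)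
  let C : Matrix κ (ι ⊕ ι') ℝ := fun i k => Sum.elim (fun l => |A i l|) (fun l => |B i l|) k
  let φ : ℝ → ℝ := fun s =>
    ∫ g, logSumExp w (M s *ᵥ g) ∂(Measure.pi fun _ => gaussianReal 0 1)
  have hM : ∀ t i k, HasDerivAt (fun s => M s i k) (M' t i k) t := by
    rintro t i (k | k)
    · simpa [M, M'] using (Real.hasDerivAt_cos t).mul_const (A i k)
    · simpa [M, M'] using (Real.hasDerivAt_sin t).mul_const (B i k)
  have hC : ∀ t i k, |M' t i k| ≤ C i k := by
    rintro t i (k | k)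
    · simpa [M', C, abs_mul] using
        mul_le_of_le_one_left (abs_nonneg (A i k)) (Real.abs_sin_le_one t)
    · simpa [M', C, abs_mul] using
        mul_le_of_le_one_left (abs_nonneg (B i k)) (Real.abs_cos_le_one t)
  have hφ := hasDerivAt_integral_logSumExp_mulVec hw hM hC
  have hmono : MonotoneOn φ (Set.Icc 0 (Real.pi / 2)) := by
    refine monotoneOn_of_deriv_nonneg (convex_Icc _ _)
      (fun t _ => (hφ t).continuousAt.continuousWithinAt)
      (fun t _ => (hφ t).differentiableAt.differentiableWithinAt) fun t ht => ?_
    rw [interior_Icc] at ht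
    have hs : 0 ≤ Real.sin t :=
      Real.sin_nonneg_of_nonneg_of_le_pi ht.1.le (by linarith [ht.2, Real.pi_pos])
    have hc : 0 ≤ Real.cos t :=
      Real.cos_nonneg_of_neg_pi_div_two_le_of_le (by linarith [ht.1, Real.pi_pos]) ht.2.le
    rw [(hφ t).deriv, integral_sum_gibbsWeight_mul_mulVec hw]
    refine integral_nonneg fun g => mul_nonneg (by norm_num)
      (Finset.sum_nonneg fun i _ => Finset.sum_nonneg fun j _ => mul_nonneg
        (mul_nonneg (gibbsWeight_nonneg hw _ i) (gibbsWeight_nonneg hw _ j)) ?_)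
    have : ∑ k, (M' t i k - M' t j k) * (M t i k - M t j k)
        = Real.sin t * Real.cos t *
          (∑ k, (B i k - B j k) ^ 2 - ∑ k, (A i k - A j k) ^ 2) := by
      simp only [M, M', Fintype.sum_sum_type, Matrix.fromCols_apply_inl,
        Matrix.fromCols_apply_inr, Matrix.smul_apply, smul_eq_mul]
      rw [mul_sub, Finset.mul_sum, Finset.mul_sum, sub_eq_neg_add, ← Finset.sum_neg_distrib]
      congr 1 <;> exact Finset.sum_congr rfl fun k _ => by ring
    rw [this]
    exact mul_nonneg (mul_nonneg hs hc) (sub_nonneg.2 (h i j))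
  have hsum := measurePreserving_sumPiEquivProdPi (fun _ : ι ⊕ ι' => gaussianReal 0 1)
  have hl := measurePreserving_fst.comp hsum
  have hr := measurePreserving_snd.comp hsum
  have h0 : φ 0 = ∫ g, logSumExp w (A *ᵥ g) ∂(Measure.pi fun _ => gaussianReal 0 1) := by
    rw [← hl.map_eq, integral_map hl.measurable.aemeasurable
      (by rw [hl.map_eq]; exact (integrable_logSumExp_mulVec hw A).aestronglyMeasurable)]
    refine integral_congr_ae (ae_of_all _ fun g => ?_)
    simp only [M, Real.cos_zero, Real.sin_zero, one_smul, zero_smul, Matrix.fromCols_mulVec,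
      Matrix.zero_mulVec, add_zero]
    rfl
  have h1 : φ (Real.pi / 2)
      = ∫ g, logSumExp w (B *ᵥ g) ∂(Measure.pi fun _ => gaussianReal 0 1) := by
    rw [← hr.map_eq, integral_map hr.measurable.aemeasurable
      (by rw [hr.map_eq]; exact (integrable_logSumExp_mulVec hw B).aestronglyMeasurable)]
    refine integral_congr_ae (ae_of_all _ fun g => ?_)
    simp only [M, Real.cos_pi_div_two, Real.sin_pi_div_two, one_smul, zero_smul,
      Matrix.fromCols_mulVec, Matrix.zero_mulVec, zero_add]
    rfl
  rw [← h0, ← h1]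
  have hpi : (0 : ℝ) ≤ Real.pi / 2 := by positivity
  exact hmono ⟨le_rfl, hpi⟩ ⟨hpi, le_rfl⟩ hpi

end Interpolation

lemma integral_sub_sq_map_mulVec {κ ι : Type*} [Fintype κ] [Fintype ι] (A : Matrix κ ι ℝ)
    (i j : κ) :
    ∫ x, (x i - x j) ^ 2 ∂((Measure.pi fun _ : ι => gaussianReal 0 1).map A.mulVec)
      = ∑ k, (A i k - A j k) ^ 2 := by
  classical
  rw [integral_map (by fun_prop : Continuous A.mulVec).aemeasurable
    (by fun_prop : Continuous fun x : κ → ℝ => (x i - x j) ^ 2).aestronglyMeasurable]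
  simpa [Matrix.mulVec, sub_dotProduct] using integral_dotProduct_sq_pi_gaussianReal (A i - A j)

/-- **Generalized comparison.** If `d_Y(i,j) ≥ d_X(i,j)` for all `i, j`, where
`d_X(i,j) = √(E[(Xᵢ−Xⱼ)²])`, then `E[log Σᵢ wᵢ e^{Yᵢ}] ≥ E[log Σᵢ wᵢ e^{Xᵢ}]`. -/
theorem generalized_comparison (n : ℕ)
    (μX μY : Measure (Fin n → ℝ)) (CX CY : Matrix (Fin n) (Fin n) ℝ)
    (hX : IsCenteredGaussian n μX CX) (hY : IsCenteredGaussian n μY CY)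
    (w : Fin n → ℝ) (hw : ∀ i, 0 < w i)
    (hd : ∀ i j, Real.sqrt (∫ x, (x i - x j) ^ 2 ∂μX)
        ≤ Real.sqrt (∫ y, (y i - y j) ^ 2 ∂μY)) :
    (∫ x, Real.log (∑ i, w i * Real.exp (x i)) ∂μX)
      ≤ ∫ y, Real.log (∑ i, w i * Real.exp (y i)) ∂μY := by
  obtain ⟨A, -, rfl⟩ := hX
  obtain ⟨B, -, rfl⟩ := hY
  cases isEmpty_or_nonempty (Fin n)
  · simp
  simp only [stdGaussianPi, integral_sub_sq_map_mulVec] at hd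
  have hAB : ∀ i j, ∑ k, (A i k - A j k) ^ 2 ≤ ∑ k, (B i k - B j k) ^ 2 := fun i j =>
    (Real.sqrt_le_sqrt_iff (Finset.sum_nonneg fun k _ => sq_nonneg _)).1 (hd i j)
  have hmap : ∀ D : Matrix (Fin n) (Fin n) ℝ,
      ∫ x, Real.log (∑ i, w i * Real.exp (x i)) ∂((stdGaussianPi n).map D.mulVec)
        = ∫ g, logSumExp w (D.mulVec g) ∂(Measure.pi fun _ => gaussianReal 0 1) := fun D =>
    integral_map (by fun_prop : Continuous D.mulVec).aemeasurable
      (continuous_logSumExp hw).aestronglyMeasurable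
  rw [hmap, hmap]
  exact integral_logSumExp_mulVec_le hw A B hAB
end
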